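/- (Consistency of the AdjacentChain estimator at the level of expectations.) Under the hypotheses of Proposition 3.1, suppose that for every j ∈ {1,…,k−1} the expected interventional-set relevance r_{j,j+1} > 0 and every propensity p_j > 0. Then the telescoping product of expected adjacent click-rate ratios recovers the relative propensity: ∏_{j=1}^{k−1} E[ĉ_{j+1}^{j,j+1}] / E[ĉ_j^{j,j+1}] = p_k / p_1. -/

import Mathlib

/-- Real-valued indicator of a proposition. -/
noncomputable def indR (P : Prop) : ℝ := @ite ℝ P (Classical.propDecidable P) 1 0

/-- Membership of the pair `(q, d)` in the interventional set `S_{k,k'}`: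
`d` is a candidate for `q`, some ranker puts `d` at rank `k` for `q`,
and some (other) ranker puts `d` at rank `k'` for `q`. -/
def Smem {Q D : Type*} (m : ℕ) (rnk : Fin m → Q → D → ℕ) (Ω : Q → Finset D)
    (q : Q) (d : D) (k k' : ℕ) : Prop :=
  d ∈ Ω q ∧ (∃ i : Fin m, rnk i q d = k) ∧ (∃ i' : Fin m, rnk i' q d = k')

/-- The weight `w(q,d,k) = ∑_i n_i · 1[rank(d | f_i(q)) = k]`. -/
noncomputable def wgt {Q D : Type*} (m : ℕ) (n : Fin m → ℕ) (rnk : Fin m → Q → D → ℕ)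
    (q : Q) (d : D) (k : ℕ) : ℝ :=
  ∑ i : Fin m, (n i : ℝ) * indR (rnk i q d = k)

/-- The expected weighted click rate `E[ĉ_pos^{a,b}]` at position `pos` restricted to
the interventional set `S_{a,b}`: the click indicators in `ĉ_pos^{a,b}` are replaced by
the PBM click probability `p pos · rel q d` and logged queries by the expectation over
`q ~ Pr(Q)`. -/
noncomputable def expClickRate {Q D : Type*} [Fintype Q]
    (Pr : Q → ℝ) (Ω : Q → Finset D) (rel : Q → D → ℝ)
    (m : ℕ) (n : Fin m → ℕ) (rnk : Fin m → Q → D → ℕ)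
    (p : ℕ → ℝ) (a b pos : ℕ) : ℝ :=
  ∑ i : Fin m, ∑ _j ∈ Finset.range (n i), ∑ q : Q, Pr q *
    ∑ d ∈ Ω q, indR (Smem m rnk Ω q d a b) * indR (rnk i q d = pos) *
      (p pos * rel q d) / wgt m n rnk q d pos

theorem indR_nonneg (P : Prop) : 0 ≤ indR P := by
  unfold indR
  split_ifs <;> norm_num

theorem indR_of_true {P : Prop} (h : P) : indR P = 1 := if_pos h

theorem indR_of_false {P : Prop} (h : ¬P) : indR P = 0 := if_neg h

theorem wgt_pos {Q D : Type*} {m : ℕ} {n : Fin m → ℕ} {rnk : Fin m → Q → D → ℕ}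
    (hn : ∀ i, 0 < n i) {q : Q} {d : D} {k : ℕ} (h : ∃ i, rnk i q d = k) :
    0 < wgt m n rnk q d k := by
  obtain ⟨i, hi⟩ := h
  refine Finset.sum_pos' (fun j _ => mul_nonneg (Nat.cast_nonneg _) (indR_nonneg _))
    ⟨i, Finset.mem_univ i, ?_⟩
  rw [indR_of_true hi, mul_one]
  exact_mod_cast hn i

/-- The expected weighted click rate at a position shared by the whole interventional set
is the propensity of that position times the expected relevance of the set. -/
theorem expClickRate_eq {Q D : Type*} [Fintype Q]
    (Pr : Q → ℝ) (Ω : Q → Finset D) (rel : Q → D → ℝ)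
    {m : ℕ} {n : Fin m → ℕ} (rnk : Fin m → Q → D → ℕ) (p : ℕ → ℝ) {a b pos : ℕ}
    (hn : ∀ i, 0 < n i) (hpos : pos = a ∨ pos = b) :
    expClickRate Pr Ω rel m n rnk p a b pos =
      p pos * ∑ q : Q, Pr q * ∑ d ∈ Ω q, indR (Smem m rnk Ω q d a b) * rel q d := by
  have cancel (q : Q) (d : D) :
      ∑ i : Fin m, (n i : ℝ) * (indR (Smem m rnk Ω q d a b) * indR (rnk i q d = pos) *
          (p pos * rel q d) / wgt m n rnk q d pos) =
        p pos * (indR (Smem m rnk Ω q d a b) * rel q d) := by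
    by_cases hS : Smem m rnk Ω q d a b
    · have hw : wgt m n rnk q d pos ≠ 0 := by
        refine (wgt_pos hn ?_).ne'
        rcases hpos with rfl | rfl
        exacts [hS.2.1, hS.2.2]
      calc
        _ = ∑ i : Fin m, (n i : ℝ) * indR (rnk i q d = pos) *
              (p pos * rel q d / wgt m n rnk q d pos) := by
          refine Finset.sum_congr rfl fun i _ => ?_
          rw [indR_of_true hS]
          ring
        _ = wgt m n rnk q d pos * (p pos * rel q d / wgt m n rnk q d pos) := by
          rw [← Finset.sum_mul, wgt]
        _ = _ := by
          rw [indR_of_true hS, mul_div_cancel₀ _ hw, one_mul]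
    · simp [indR_of_false hS]
  simp only [expClickRate, Finset.sum_const, Finset.card_range, nsmul_eq_mul, Finset.mul_sum]
  rw [Finset.sum_comm]
  refine Finset.sum_congr rfl fun q _ => ?_
  rw [Finset.sum_comm]
  refine Finset.sum_congr rfl fun d _ => ?_
  rw [mul_left_comm, ← cancel, Finset.mul_sum]
  exact Finset.sum_congr rfl fun i _ => mul_left_comm _ _ _

theorem prod_Icc_div_of_pos (p : ℕ → ℝ) (k : ℕ) (h : ∀ j, 1 ≤ j → j ≤ k + 1 → 0 < p j) :
    ∏ j ∈ Finset.Icc 1 k, p (j + 1) / p j = p (k + 1) / p 1 := by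
  induction k with
  | zero => simp [(h 1 le_rfl le_rfl).ne']
  | succ k ih =>
    rw [Finset.prod_Icc_succ_top (by omega), ih fun j h1 h2 => h j h1 (by omega), mul_comm]
    exact div_mul_div_cancel₀ (h (k + 1) (by omega) (by omega)).ne'

/-- **consistency of the AdjacentChain estimator at the level of
expectations.** Under the hypotheses of Proposition 3.1, suppose that for every
`j ∈ {1,…,k−1}` the expected interventional-set relevance `r_{j,j+1} > 0`, and that
every propensity `p j > 0` for `j ∈ {1,…,k}`.  Then the telescoping product of expected
adjacent click-rate ratios recovers the relative propensity:
`∏_{j=1}^{k−1} E[ĉ_{j+1}^{j,j+1}] / E[ĉ_j^{j,j+1}] = p k / p 1`. -/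
theorem adjacentChain_consistent_in_expectation {Q D : Type*} [Fintype Q]
    (Pr : Q → ℝ) (Ω : Q → Finset D) (rel : Q → D → ℝ)
    (m : ℕ) (n : Fin m → ℕ) (rnk : Fin m → Q → D → ℕ)
    (p : ℕ → ℝ) (k : ℕ)
    (hk : 1 ≤ k)
    (hrel : ∀ q d, rel q d = 0 ∨ rel q d = 1)
    (hp : ∀ j, 0 ≤ p j ∧ p j ≤ 1)
    (hPr : ∀ q, 0 ≤ Pr q) (hPrsum : ∑ q : Q, Pr q = 1)
    (hn : ∀ i, 0 < n i)
    (hr : ∀ j, 1 ≤ j → j ≤ k - 1 →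
      0 < ∑ q : Q, Pr q * ∑ d ∈ Ω q, indR (Smem m rnk Ω q d j (j + 1)) * rel q d)
    (hppos : ∀ j, 1 ≤ j → j ≤ k → 0 < p j) :
    ∏ j ∈ Finset.Icc 1 (k - 1),
        expClickRate Pr Ω rel m n rnk p j (j + 1) (j + 1)
          / expClickRate Pr Ω rel m n rnk p j (j + 1) j
      = p k / p 1 := by
  obtain ⟨k, rfl⟩ := Nat.exists_eq_add_of_le' hk
  rw [← prod_Icc_div_of_pos p k hppos]
  refine Finset.prod_congr rfl fun j hj => ?_
  obtain ⟨h1, h2⟩ := Finset.mem_Icc.mp hj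
  rw [expClickRate_eq Pr Ω rel rnk p hn (Or.inr rfl),
    expClickRate_eq Pr Ω rel rnk p hn (Or.inl rfl),
    mul_div_mul_right _ _ (hr j h1 h2).ne']
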